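/- arXiv:2306.05975 — 3 statements merged into one kernel-verified Lean document; each statement's English description precedes it below -/
import Mathlib

section
/- Let {η1^{(i)}}_{i=0}^{q1} ⊂ [−1,1] with positive weights {ω1^{(i)}} form a quadrature rule exact of degree τ1 ≥ 2q1, and let {η2^{(i)}}_{i=0}^{q2} ⊂ [−1,1) with positive weights {ω2^{(i)}} form a rule exact of degree τ2 ≥ 2q2. With ℓ1^{(i)}, ℓ2^{(i)} the Lagrange bases on these nodes, define Q^{(1)}_{(α1,α2),(β1,β2)} = ω1^{(α1)} ω2^{(α2)} ((1−η2^{(α2)})/2) · (2/(1−η2^{(α2)})) (ℓ1^{(β1)})'(η1^{(α1)}) δ_{α2β2}. Then the summation-by-parts identity in the ξ1 direction holds: for all multi-indices (α1,α2), (β1,β2), Q^{(1)}_{(α1,α2),(β1,β2)} + Q^{(1)}_{(β1,β2),(α1,α2)} = [ℓ1^{(α1)}(1) ℓ1^{(β1)}(1) − ℓ1^{(α1)}(−1) ℓ1^{(β1)}(−1)] · ∫_{−1}^{1} ℓ2^{(α2)}(s) ℓ2^{(β2)}(s) ds. -/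
noncomputable section

/-- The collapsed coordinate map from the square onto the reference triangle. -/
def chi2 (η : ℝ × ℝ) : ℝ × ℝ := ((1 + η.1) * (1 - η.2) / 2 - 1, η.2)

/-- Lagrange basis function on the nodes `η`. -/
def lagr {n : ℕ} (η : Fin n → ℝ) (i : Fin n) (x : ℝ) : ℝ :=
  ∏ j ∈ Finset.univ.erase i, (x - η j) / (η i - η j)

/-- Evaluation of a bivariate polynomial at a point of `ℝ × ℝ`. -/
def ev2 (v : MvPolynomial (Fin 2) ℝ) (x : ℝ × ℝ) : ℝ := MvPolynomial.eval ![x.1, x.2] v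

/-- The reference triangle `T̂ = {ξ ∈ [−1,1]² : ξ1 + ξ2 ≤ 0}`. -/
def refTri : Set (ℝ × ℝ) :=
  {ξ | ξ.1 ∈ Set.Icc (-1:ℝ) 1 ∧ ξ.2 ∈ Set.Icc (-1:ℝ) 1 ∧ ξ.1 + ξ.2 ≤ 0}

/-- A one-dimensional quadrature rule with nodes `η` and weights `ω` is exact of degree `τ`. -/
def exact1D {n : ℕ} (η ω : Fin n → ℝ) (τ : ℕ) : Prop :=
  ∀ f : Polynomial ℝ, f.natDegree ≤ τ →
    ∑ i, ω i * f.eval (η i) = ∫ x in (-1:ℝ)..1, f.eval x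

theorem lagr_eq_eval_basis {n : ℕ} (η : Fin n → ℝ) (i : Fin n) (x : ℝ) :
    lagr η i x = (Lagrange.basis Finset.univ η i).eval x := by
  simp only [lagr, Lagrange.basis, Lagrange.basisDivisor, Polynomial.eval_prod,
    Polynomial.eval_mul, Polynomial.eval_C, Polynomial.eval_sub, Polynomial.eval_X]
  exact Finset.prod_congr rfl fun j _ => div_eq_inv_mul _ _

theorem deriv_lagr {n : ℕ} (η : Fin n → ℝ) (i : Fin n) (x : ℝ) :
    deriv (lagr η i) x = (Lagrange.basis Finset.univ η i).derivative.eval x := by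
  rw [funext (lagr_eq_eval_basis η i), Polynomial.deriv]

theorem eval_basis_node {n : ℕ} {η : Fin n → ℝ} (hη : Function.Injective η) (i j : Fin n) :
    (Lagrange.basis Finset.univ η i).eval (η j) = if j = i then 1 else 0 := by
  split_ifs with h
  · rw [h, Lagrange.eval_basis_self hη.injOn (Finset.mem_univ i)]
  · exact Lagrange.eval_basis_of_ne (Ne.symm h) (Finset.mem_univ j)

theorem natDegree_basis_mul_basis_le {q : ℕ} {η : Fin (q + 1) → ℝ}
    (hη : Function.Injective η) (i j : Fin (q + 1)) :
    (Lagrange.basis Finset.univ η i * Lagrange.basis Finset.univ η j).natDegree ≤ 2 * q := by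
  have hdeg (k : Fin (q + 1)) : (Lagrange.basis Finset.univ η k).natDegree ≤ q := by
    apply Polynomial.natDegree_le_of_degree_le
    simp [Lagrange.degree_basis hη.injOn (Finset.mem_univ k)]
  linarith [Polynomial.natDegree_mul_le (p := Lagrange.basis Finset.univ η i)
    (q := Lagrange.basis Finset.univ η j), hdeg i, hdeg j]

/-- The Lagrange basis is orthogonal when the quadrature on its nodes is exact of degree `2 * q`. -/
theorem integral_lagr_mul_lagr {q τ : ℕ} {η ω : Fin (q + 1) → ℝ}
    (hη : Function.Injective η) (hτ : 2 * q ≤ τ) (he : exact1D η ω τ) (i j : Fin (q + 1)) :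
    ∫ s in (-1:ℝ)..1, lagr η i s * lagr η j s = if i = j then ω i else 0 := by
  have h := he _ ((natDegree_basis_mul_basis_le hη i j).trans hτ)
  simp only [Polynomial.eval_mul, eval_basis_node hη] at h
  simp only [lagr_eq_eval_basis, ← h]
  rcases eq_or_ne i j with rfl | hij
  · simp
  · simp [hij, hij.symm]

/-- One-dimensional summation by parts for the Lagrange differentiation matrix. -/
theorem weighted_deriv_lagr_add {q τ : ℕ} {η ω : Fin (q + 1) → ℝ}
    (hη : Function.Injective η) (hτ : 2 * q ≤ τ) (he : exact1D η ω τ) (i j : Fin (q + 1)) :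
    ω i * deriv (lagr η j) (η i) + ω j * deriv (lagr η i) (η j) =
      lagr η i 1 * lagr η j 1 - lagr η i (-1) * lagr η j (-1) := by
  set p := Lagrange.basis Finset.univ η i * Lagrange.basis Finset.univ η j with hp
  have hdeg : p.derivative.natDegree ≤ τ :=
    (Polynomial.natDegree_derivative_le p).trans
      ((Nat.sub_le _ _).trans ((natDegree_basis_mul_basis_le hη i j).trans hτ))
  have h := he _ hdeg
  rw [intervalIntegral.integral_eq_sub_of_hasDerivAt (fun x _ => p.hasDerivAt x)
    (p.derivative.continuous.intervalIntegrable _ _)] at h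
  simp only [hp, Polynomial.derivative_mul, Polynomial.eval_add, Polynomial.eval_mul,
    eval_basis_node hη, mul_add, Finset.sum_add_distrib] at h
  simp only [deriv_lagr, lagr_eq_eval_basis, ← h]
  simp [add_comm]

theorem sbp_property_xi1_triangle (q1 q2 τ1 τ2 : ℕ)
    (η1 ω1 : Fin (q1 + 1) → ℝ) (η2 ω2 : Fin (q2 + 1) → ℝ)
    (hinj1 : Function.Injective η1) (hinj2 : Function.Injective η2)
    (hr1 : ∀ i, η1 i ∈ Set.Icc (-1:ℝ) 1) (hr2 : ∀ i, η2 i ∈ Set.Ico (-1:ℝ) 1)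
    (hw1 : ∀ i, 0 < ω1 i) (hw2 : ∀ i, 0 < ω2 i)
    (hτ1 : 2 * q1 ≤ τ1) (hτ2 : 2 * q2 ≤ τ2)
    (he1 : exact1D η1 ω1 τ1) (he2 : exact1D η2 ω2 τ2)
    (Q : (Fin (q1 + 1) × Fin (q2 + 1)) → (Fin (q1 + 1) × Fin (q2 + 1)) → ℝ)
    (hQ : ∀ a b, Q a b = ω1 a.1 * ω2 a.2 * ((1 - η2 a.2) / 2) *
      ((2 / (1 - η2 a.2)) * deriv (lagr η1 b.1) (η1 a.1) *
        (if a.2 = b.2 then (1:ℝ) else 0))) :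
    ∀ a b, Q a b + Q b a =
      (lagr η1 a.1 1 * lagr η1 b.1 1 - lagr η1 a.1 (-1) * lagr η1 b.1 (-1)) *
        ∫ s in (-1:ℝ)..1, lagr η2 a.2 s * lagr η2 b.2 s := by
  intro a b
  rw [integral_lagr_mul_lagr hinj2 hτ2 he2, ← weighted_deriv_lagr_add hinj1 hτ1 he1, hQ, hQ]
  by_cases h : a.2 = b.2
  · have hne : 1 - η2 b.2 ≠ 0 := (sub_pos.mpr (hr2 b.2).2).ne'
    simp only [h, if_true]
    field_simp
  · simp [h, Ne.symm h]
end
end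

section
/- Let q1, q2, q3 ∈ ℕ and q = min(q1, q2, q3). Given q1+1 distinct nodes {η1^{(i)}} ⊂ [−1,1], q2+1 distinct nodes {η2^{(i)}} ⊂ [−1,1), and q3+1 distinct nodes {η3^{(i)}} ⊂ [−1,1), the three-dimensional tensor-product interpolation operator I_q is exact for every trivariate polynomial v of total degree at most q: for all (η1, η2, η3) ∈ [−1,1]³, ∑_{α1=0}^{q1} ∑_{α2=0}^{q2} ∑_{α3=0}^{q3} v(χ(η1^{(α1)}, η2^{(α2)}, η3^{(α3)})) ℓ1^{(α1)}(η1) ℓ2^{(α2)}(η2) ℓ3^{(α3)}(η3) = v(χ(η1, η2, η3)). In particular (I_q v)(ξ) = v(ξ) for all ξ ∈ T̂ \ {(−1,1,−1), (−1,−1,1)}. -/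
noncomputable section

/-- The collapsed coordinate map from the cube onto the reference tetrahedron. -/
def chi3 (η : ℝ × ℝ × ℝ) : ℝ × ℝ × ℝ :=
  ((1 + η.1) * (1 - η.2.1) * (1 - η.2.2) / 4 - 1,
   (1 + η.2.1) * (1 - η.2.2) / 2 - 1, η.2.2)

/-- Evaluation of a trivariate polynomial at a point of `ℝ × ℝ × ℝ`. -/
def ev3 (v : MvPolynomial (Fin 3) ℝ) (x : ℝ × ℝ × ℝ) : ℝ :=
  MvPolynomial.eval ![x.1, x.2.1, x.2.2] v

/-- The reference tetrahedron `T̂ = {ξ ∈ [−1,1]³ : ξ1 + ξ2 + ξ3 ≤ −1}`. -/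
def refTet : Set (ℝ × ℝ × ℝ) :=
  {ξ | ξ.1 ∈ Set.Icc (-1:ℝ) 1 ∧ ξ.2.1 ∈ Set.Icc (-1:ℝ) 1 ∧ ξ.2.2 ∈ Set.Icc (-1:ℝ) 1 ∧
    ξ.1 + ξ.2.1 + ξ.2.2 ≤ -1}

/-- Lagrange interpolation is exact on univariate polynomials of degree at most `n`. -/
theorem sum_eval_mul_lagr {n : ℕ} {η : Fin (n + 1) → ℝ} (hη : Function.Injective η)
    {f : Polynomial ℝ} (hf : f.natDegree ≤ n) (x : ℝ) :
    ∑ i, f.eval (η i) * lagr η i x = f.eval x := by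
  have hdeg : f.degree < (Finset.univ : Finset (Fin (n + 1))).card := by
    rw [Finset.card_fin]
    exact Polynomial.degree_le_natDegree.trans_lt (by exact_mod_cast Nat.lt_succ_of_le hf)
  conv_rhs => rw [Lagrange.eq_interpolate hη.injOn hdeg, Lagrange.interpolate_apply,
    Polynomial.eval_finsetSum]
  refine Finset.sum_congr rfl fun i _ => ?_
  simp [lagr, Lagrange.basis, Lagrange.basisDivisor, Polynomial.eval_prod, div_eq_inv_mul]

/-- Lagrange interpolation is exact on polynomials of total degree at most `n` restricted to
a line. -/
theorem sum_ev3_line_mul_lagr {n : ℕ} {η : Fin (n + 1) → ℝ} (hη : Function.Injective η)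
    {v : MvPolynomial (Fin 3) ℝ} (hv : v.totalDegree ≤ n) (γ : ℝ → ℝ × ℝ × ℝ)
    (a b : ℝ × ℝ × ℝ) (hγ : ∀ t, γ t = a + t • b) (x : ℝ) :
    ∑ i, ev3 v (γ (η i)) * lagr η i x = ev3 v (γ x) := by
  obtain ⟨g, hg⟩ : ∃ g : Fin 3 → Polynomial ℝ, ∀ k, g k =
      Polynomial.C (![b.1, b.2.1, b.2.2] k) * Polynomial.X +
        Polynomial.C (![a.1, a.2.1, a.2.2] k) := ⟨_, fun _ => rfl⟩
  have heval (t : ℝ) : ev3 v (γ t) = (MvPolynomial.aeval g v).eval t := by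
    rw [← Polynomial.coe_evalRingHom, MvPolynomial.aeval_def, MvPolynomial.hom_eval₂, ev3,
      MvPolynomial.eval, MvPolynomial.coe_eval₂Hom]
    congr 1
    · ext r; simp
    · ext k; fin_cases k <;> simp [hg, hγ] <;> ring
  have hdeg : (MvPolynomial.aeval g v).natDegree ≤ n := by
    refine (MvPolynomial.aeval_natDegree_le v hv g (n := 1) fun k => ?_).trans (by simp)
    rw [hg]
    exact Polynomial.natDegree_linear_le
  simp only [heval]
  exact sum_eval_mul_lagr hη hdeg x

theorem tensor_product_interpolation_exact_tetrahedron (q1 q2 q3 : ℕ)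
    (η1 : Fin (q1 + 1) → ℝ) (η2 : Fin (q2 + 1) → ℝ) (η3 : Fin (q3 + 1) → ℝ)
    (hinj1 : Function.Injective η1) (hinj2 : Function.Injective η2)
    (hinj3 : Function.Injective η3)
    (hr1 : ∀ i, η1 i ∈ Set.Icc (-1:ℝ) 1) (hr2 : ∀ i, η2 i ∈ Set.Ico (-1:ℝ) 1)
    (hr3 : ∀ i, η3 i ∈ Set.Ico (-1:ℝ) 1)
    (v : MvPolynomial (Fin 3) ℝ) (hv : v.totalDegree ≤ min q1 (min q2 q3))
    (x1 x2 x3 : ℝ) (hx1 : x1 ∈ Set.Icc (-1:ℝ) 1) (hx2 : x2 ∈ Set.Icc (-1:ℝ) 1)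
    (hx3 : x3 ∈ Set.Icc (-1:ℝ) 1) :
    ∑ a1 : Fin (q1 + 1), ∑ a2 : Fin (q2 + 1), ∑ a3 : Fin (q3 + 1),
      ev3 v (chi3 (η1 a1, η2 a2, η3 a3)) * lagr η1 a1 x1 * lagr η2 a2 x2 * lagr η3 a3 x3
      = ev3 v (chi3 (x1, x2, x3)) := by
  have h1 : v.totalDegree ≤ q1 := hv.trans (min_le_left _ _)
  have h2 : v.totalDegree ≤ q2 := hv.trans ((min_le_right _ _).trans (min_le_left _ _))
  have h3 : v.totalDegree ≤ q3 := hv.trans ((min_le_right _ _).trans (min_le_right _ _))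
  have e3 (y1 y2 : ℝ) := sum_ev3_line_mul_lagr hinj3 h3 (fun t => chi3 (y1, y2, t))
    ((1 + y1) * (1 - y2) / 4 - 1, (1 + y2) / 2 - 1, 0)
    (-((1 + y1) * (1 - y2) / 4), -((1 + y2) / 2), 1)
    (fun t => by ext <;> simp [chi3] <;> ring) x3
  have e2 (y1 : ℝ) := sum_ev3_line_mul_lagr hinj2 h2 (fun t => chi3 (y1, t, x3))
    ((1 + y1) * (1 - x3) / 4 - 1, (1 - x3) / 2 - 1, x3)
    (-((1 + y1) * (1 - x3) / 4), (1 - x3) / 2, 0)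
    (fun t => by ext <;> simp [chi3] <;> ring) x2
  have e1 := sum_ev3_line_mul_lagr hinj1 h1 (fun t => chi3 (t, x2, x3))
    ((1 - x2) * (1 - x3) / 4 - 1, (1 + x2) * (1 - x3) / 2 - 1, x3)
    ((1 - x2) * (1 - x3) / 4, 0, 0)
    (fun t => by ext <;> simp [chi3]; ring) x1
  rw [← e1]
  refine Finset.sum_congr rfl fun a1 _ => ?_
  rw [← e2, Finset.sum_mul]
  refine Finset.sum_congr rfl fun a2 _ => ?_
  rw [← e3, Finset.sum_mul, Finset.sum_mul]
  exact Finset.sum_congr rfl fun a3 _ => by ring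
end
end

section
/- Let s ∈ ℕ. Suppose the one-dimensional rules with nodes {η1^{(i)}} ⊂ [−1,1], {η2^{(i)}} ⊂ [−1,1), {η3^{(i)}} ⊂ [−1,1) and weights {ω1^{(i)}}, {ω2^{(i)}}, {ω3^{(i)}} are exact of degrees τ1 ≥ s, τ2 ≥ s+1, and τ3 ≥ s+2, respectively. Define three-dimensional nodes ξ^{(α1,α2,α3)} = χ(η1^{(α1)}, η2^{(α2)}, η3^{(α3)}) and weights ω^{(α1,α2,α3)} = ((1−η2^{(α2)})(1−η3^{(α3)})²/8) ω1^{(α1)} ω2^{(α2)} ω3^{(α3)}. Then for every trivariate polynomial v of total degree at most s, ∑_{α1,α2,α3} ω^{(α1,α2,α3)} v(ξ^{(α1,α2,α3)}) = ∫_{T̂} v(ξ) dξ. -/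
noncomputable section

open MeasureTheory in
lemma integral_indicator_Icc {a b : ℝ} (hab : a ≤ b) (g : ℝ → ℝ) :
    ∫ x, (Set.Icc a b).indicator g x = ∫ x in a..b, g x := by
  rw [integral_indicator measurableSet_Icc, integral_Icc_eq_integral_Ioc,
    intervalIntegral.integral_of_le hab]

lemma mem_refTet_iff (x y z : ℝ) :
    (x, y, z) ∈ refTet ↔
      z ∈ Set.Icc (-1 : ℝ) 1 ∧ y ∈ Set.Icc (-1) (-z) ∧ x ∈ Set.Icc (-1) (-1 - y - z) := by
  simp only [refTet, Set.mem_ofPred_eq, Set.mem_Icc]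
  constructor
  · rintro ⟨⟨_, _⟩, ⟨_, _⟩, ⟨_, _⟩, _⟩
    refine ⟨⟨?_, ?_⟩, ⟨?_, ?_⟩, ?_, ?_⟩ <;> linarith
  · rintro ⟨⟨_, _⟩, ⟨_, _⟩, _, _⟩
    refine ⟨⟨?_, ?_⟩, ⟨?_, ?_⟩, ⟨?_, ?_⟩, ?_⟩ <;> linarith

lemma isCompact_refTet : IsCompact refTet := by
  have hset : refTet = (Set.Icc (-1 : ℝ) 1 ×ˢ Set.Icc (-1 : ℝ) 1 ×ˢ Set.Icc (-1 : ℝ) 1) ∩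
      {ξ : ℝ × ℝ × ℝ | ξ.1 + ξ.2.1 + ξ.2.2 ≤ -1} := by
    ext ξ
    simp only [refTet, Set.mem_inter_iff, Set.mem_prod, Set.mem_ofPred_eq, and_assoc]
  rw [hset]
  exact (isCompact_Icc.prod (isCompact_Icc.prod isCompact_Icc)).inter_right
    (isClosed_le (by fun_prop) continuous_const)

open MeasureTheory in
/-- Fubini's theorem on the reference tetrahedron. -/
lemma setIntegral_refTet {f : ℝ × ℝ × ℝ → ℝ} (hf : Continuous f) :
    ∫ ξ in refTet, f ξ =
      ∫ z in (-1 : ℝ)..1, ∫ y in (-1)..(-z), ∫ x in (-1)..(-1 - y - z), f (x, y, z) := by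
  have hmeas : MeasurableSet refTet := isCompact_refTet.measurableSet
  have hint : Integrable (refTet.indicator f) :=
    (integrable_indicator_iff hmeas).2 (hf.continuousOn.integrableOn_compact isCompact_refTet)
  rw [← integral_indicator hmeas, Measure.volume_eq_prod, integral_prod_symm _ hint,
    Measure.volume_eq_prod, integral_prod_symm _ hint.integral_prod_right,
    ← integral_indicator_Icc (by norm_num)]
  refine integral_congr_ae (.of_forall fun z => ?_)
  by_cases hz : z ∈ Set.Icc (-1 : ℝ) 1
  · simp only [Set.indicator_of_mem hz]
    rw [← integral_indicator_Icc (by linarith [hz.2])]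
    refine integral_congr_ae (.of_forall fun y => ?_)
    by_cases hy : y ∈ Set.Icc (-1) (-z)
    · simp only [Set.indicator_of_mem hy]
      rw [← integral_indicator_Icc (by linarith [hy.2])]
      refine integral_congr_ae (.of_forall fun x => ?_)
      simp [Set.indicator, mem_refTet_iff, -Set.mem_Icc, hz, hy]
    · simp [mem_refTet_iff, -Set.mem_Icc, hy]
  · simp [mem_refTet_iff, -Set.mem_Icc, hz]

lemma integral_neg_one_eq_rescale (c : ℝ) (g : ℝ → ℝ) :
    ∫ x in (-1)..(2 * c - 1), g x = ∫ t in (-1 : ℝ)..1, c * g ((1 + t) * c - 1) := by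
  rw [intervalIntegral.integral_const_mul]
  have h := intervalIntegral.mul_integral_comp_mul_add (a := -1) (b := 1) (f := g) c (c - 1)
  rw [show c * -1 + (c - 1) = -1 by ring, show c * 1 + (c - 1) = 2 * c - 1 by ring] at h
  rw [← h]
  congr 2 with t
  congr 1
  ring

/-- Integration over the reference tetrahedron in collapsed coordinates. -/
lemma setIntegral_refTet_eq_collapsed {f : ℝ × ℝ × ℝ → ℝ} (hf : Continuous f) :
    ∫ ξ in refTet, f ξ = ∫ z in (-1 : ℝ)..1, ∫ t in (-1 : ℝ)..1, ∫ u in (-1 : ℝ)..1,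
      (1 - t) * (1 - z) ^ 2 / 8 * f (chi3 (u, t, z)) := by
  rw [setIntegral_refTet hf]
  congr 1 with z
  rw [show -z = 2 * ((1 - z) / 2) - 1 by ring, integral_neg_one_eq_rescale]
  congr 1 with t
  rw [show -1 - ((1 + t) * ((1 - z) / 2) - 1) - z = 2 * ((1 - t) * (1 - z) / 4) - 1 by ring,
    integral_neg_one_eq_rescale, ← intervalIntegral.integral_const_mul]
  congr 1 with u
  rw [← mul_assoc]
  congr 1
  · ring
  · simp only [chi3]
    congr 3 <;> ring

lemma totalDegree_aeval_X_add_C_le {σ R : Type*} [CommRing R] [Nontrivial R] (c : σ → R)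
    (v : MvPolynomial σ R) :
    (MvPolynomial.aeval (fun i => MvPolynomial.X i + MvPolynomial.C (c i)) v).totalDegree ≤
      v.totalDegree := by
  rw [MvPolynomial.aeval_eq_eval₂Hom, MvPolynomial.coe_eval₂Hom, MvPolynomial.eval₂_eq]
  refine MvPolynomial.totalDegree_finsetSum_le fun m hm => ?_
  refine (MvPolynomial.totalDegree_mul _ _).trans ?_
  rw [MvPolynomial.algebraMap_eq, MvPolynomial.totalDegree_C, zero_add]
  refine (MvPolynomial.totalDegree_finsetProd _ _).trans
    (le_trans ?_ (MvPolynomial.le_totalDegree hm))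
  refine Finset.sum_le_sum fun i _ => (MvPolynomial.totalDegree_pow _ _).trans ?_
  refine (Nat.mul_le_mul_left _ (m := 1) ?_).trans (mul_one _).le
  refine (MvPolynomial.totalDegree_add _ _).trans ?_
  simp

/-- A trivariate polynomial is a combination of the products `(x + 1) ^ a * (y + 1) ^ b * z ^ c`
whose total degree is at most its own. -/
lemma exists_ev3_eq_sum_shifted (v : MvPolynomial (Fin 3) ℝ) :
    ∃ w : MvPolynomial (Fin 3) ℝ, w.totalDegree ≤ v.totalDegree ∧ ∀ x, ev3 v x =
      ∑ m ∈ w.support, w.coeff m * ((x.1 + 1) ^ m 0 * (x.2.1 + 1) ^ m 1 * x.2.2 ^ m 2) := by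
  refine ⟨_, totalDegree_aeval_X_add_C_le ![-1, -1, 0] v, fun x => ?_⟩
  have h := MvPolynomial.eval_eq' ![x.1 + 1, x.2.1 + 1, x.2.2]
    (MvPolynomial.aeval (fun i => MvPolynomial.X i + MvPolynomial.C ((![-1, -1, 0] : Fin 3 → ℝ) i)) v)
  simp only [Fin.prod_univ_three, Matrix.cons_val] at h
  rw [← h, ev3, MvPolynomial.aeval_def, MvPolynomial.eval_eval₂]
  rw [MvPolynomial.eval, MvPolynomial.coe_eval₂Hom]
  congr 1
  · ext r; simp
  · ext i; fin_cases i <;> simp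

/-- A tensor product of one-dimensional rules integrates products of polynomials exactly. -/
lemma sum_prod_eval_eq_integral {n1 n2 n3 τ1 τ2 τ3 : ℕ} {η1 ω1 : Fin n1 → ℝ}
    {η2 ω2 : Fin n2 → ℝ} {η3 ω3 : Fin n3 → ℝ} (he1 : exact1D η1 ω1 τ1)
    (he2 : exact1D η2 ω2 τ2) (he3 : exact1D η3 ω3 τ3) {p1 p2 p3 : Polynomial ℝ}
    (h1 : p1.natDegree ≤ τ1) (h2 : p2.natDegree ≤ τ2) (h3 : p3.natDegree ≤ τ3) :
    ∑ a1, ∑ a2, ∑ a3, ω1 a1 * ω2 a2 * ω3 a3 *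
        (p1.eval (η1 a1) * p2.eval (η2 a2) * p3.eval (η3 a3)) =
      ∫ z in (-1 : ℝ)..1, ∫ t in (-1 : ℝ)..1, ∫ u in (-1 : ℝ)..1,
        p1.eval u * p2.eval t * p3.eval z := by
  simp only [intervalIntegral.integral_mul_const, intervalIntegral.integral_const_mul]
  rw [← he1 p1 h1, ← he2 p2 h2, ← he3 p3 h3, Finset.sum_mul_sum, Finset.sum_mul]
  refine Finset.sum_congr rfl fun a1 _ => ?_
  rw [Finset.sum_mul]
  refine Finset.sum_congr rfl fun a2 _ => ?_
  rw [Finset.mul_sum]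
  exact Finset.sum_congr rfl fun a3 _ => by ring

open Polynomial in
lemma collapsed_shifted_monomial (a b c : ℕ) :
    ∃ p1 p2 p3 : ℝ[X], p1.natDegree ≤ a ∧ p2.natDegree ≤ a + b + 1 ∧
      p3.natDegree ≤ a + b + c + 2 ∧ ∀ u t z : ℝ,
        (1 - t) * (1 - z) ^ 2 / 8 * (((chi3 (u, t, z)).1 + 1) ^ a *
          ((chi3 (u, t, z)).2.1 + 1) ^ b * (chi3 (u, t, z)).2.2 ^ c) =
        p1.eval u * p2.eval t * p3.eval z := by
  refine ⟨C (1 / 4 ^ a / 2 ^ b / 8) * (1 + X) ^ a, (1 - X) ^ (a + 1) * (1 + X) ^ b,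
    (1 - X) ^ (a + b + 2) * X ^ c, by compute_degree, ?_, ?_, fun u t z => ?_⟩
  · have : ((1 - X : ℝ[X]) ^ (a + 1) * (1 + X) ^ b).natDegree ≤ a + 1 + b := by
      compute_degree
    omega
  · have : ((1 - X : ℝ[X]) ^ (a + b + 2) * X ^ c).natDegree ≤ a + b + 2 + c := by
      compute_degree
    omega
  · simp only [chi3, eval_mul, eval_C, eval_pow, eval_add, eval_sub, eval_one, eval_X,
      sub_add_cancel, div_pow, mul_pow]
    field_simp
    ring

theorem tensor_product_quadrature_exact_tetrahedron (s : ℕ) (q1 q2 q3 τ1 τ2 τ3 : ℕ)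
    (η1 ω1 : Fin (q1 + 1) → ℝ) (η2 ω2 : Fin (q2 + 1) → ℝ) (η3 ω3 : Fin (q3 + 1) → ℝ)
    (hr1 : ∀ i, η1 i ∈ Set.Icc (-1:ℝ) 1) (hr2 : ∀ i, η2 i ∈ Set.Ico (-1:ℝ) 1)
    (hr3 : ∀ i, η3 i ∈ Set.Ico (-1:ℝ) 1)
    (hτ1 : s ≤ τ1) (hτ2 : s + 1 ≤ τ2) (hτ3 : s + 2 ≤ τ3)
    (he1 : exact1D η1 ω1 τ1) (he2 : exact1D η2 ω2 τ2) (he3 : exact1D η3 ω3 τ3)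
    (v : MvPolynomial (Fin 3) ℝ) (hv : v.totalDegree ≤ s) :
    ∑ a1 : Fin (q1 + 1), ∑ a2 : Fin (q2 + 1), ∑ a3 : Fin (q3 + 1),
      ((1 - η2 a2) * (1 - η3 a3) ^ 2 / 8 * ω1 a1 * ω2 a2 * ω3 a3) *
        ev3 v (chi3 (η1 a1, η2 a2, η3 a3))
      = ∫ ξ in refTet, ev3 v ξ := by
  obtain ⟨w, hw, hvw⟩ := exists_ev3_eq_sum_shifted v
  simp only [hvw]
  have hint (m : Fin 3 →₀ ℕ) : MeasureTheory.IntegrableOn (fun ξ : ℝ × ℝ × ℝ =>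
      w.coeff m * ((ξ.1 + 1) ^ m 0 * (ξ.2.1 + 1) ^ m 1 * ξ.2.2 ^ m 2)) refTet :=
    Continuous.continuousOn (by fun_prop) |>.integrableOn_compact isCompact_refTet
  rw [MeasureTheory.integral_finsetSum _ fun m _ => hint m]
  simp only [Finset.mul_sum, MeasureTheory.integral_const_mul]
  simp only [Finset.sum_comm (t := w.support)]
  refine Finset.sum_congr rfl fun m hm => ?_
  have hdeg : m 0 + m 1 + m 2 ≤ s := by
    have h := (MvPolynomial.le_totalDegree hm).trans (hw.trans hv)
    rwa [Finsupp.sum_fintype _ _ fun _ => rfl, Fin.sum_univ_three] at h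
  obtain ⟨p1, p2, p3, h1, h2, h3, hp⟩ := collapsed_shifted_monomial (m 0) (m 1) (m 2)
  rw [setIntegral_refTet_eq_collapsed (by fun_prop)]
  simp only [hp]
  rw [← sum_prod_eval_eq_integral he1 he2 he3 (by omega) (by omega) (by omega)]
  simp only [Finset.mul_sum]
  refine Finset.sum_congr rfl fun a1 _ => Finset.sum_congr rfl fun a2 _ =>
    Finset.sum_congr rfl fun a3 _ => ?_
  rw [← hp]
  ring
end
end
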